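/- arXiv:2001.05593 — 3 statements merged into one kernel-verified Lean document; each statement's English description precedes it below -/
import Mathlib

section
/- Let A be a C*-algebra. (a) For any ideal I of A, J_wc(I) = I ∩ J_wc(A). (b) The sum of any two weakly central ideals of A is a weakly central ideal of A. -/
open Filter Topology Pointwise

namespace CQP

variable {R : Type*} [NonUnitalRing R] [TopologicalSpace R]

/-- `I` is a closed two-sided ideal of the (C*-)algebra `S` (a subset of the ambient algebra). -/
def IsIdealOf (I S : Set R) : Prop :=
  I ⊆ S ∧ IsClosed I ∧ (0 : R) ∈ I ∧
  (∀ x ∈ I, ∀ y ∈ I, x + y ∈ I) ∧ (∀ x ∈ I, -x ∈ I) ∧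
  (∀ x ∈ I, ∀ a ∈ S, a * x ∈ I ∧ x * a ∈ I)

/-- The centre of the algebra `S`. -/
def centerOf (S : Set R) : Set R := {z ∈ S | ∀ x ∈ S, z * x = x * z}

/-- `e` is a unit for `S` relative to (modulo) the ideal `M`. -/
def IsRelUnitMod (S M : Set R) (e : R) : Prop :=
  e ∈ S ∧ ∀ x ∈ S, x - x * e ∈ M ∧ x - e * x ∈ M

/-- `M` is a modular maximal ideal of the algebra `S`. -/
def IsModMaxIdealOf (M S : Set R) : Prop :=
  IsIdealOf M S ∧ M ≠ S ∧
  (∀ I, IsIdealOf I S → M ⊆ I → I = M ∨ I = S) ∧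
  ∃ e, IsRelUnitMod S M e

/-- The algebra `S` is weakly central. -/
def WeaklyCentral (S : Set R) : Prop :=
  (∀ M, IsModMaxIdealOf M S → ¬ centerOf S ⊆ M) ∧
  (∀ M N, IsModMaxIdealOf M S → IsModMaxIdealOf N S →
    M ∩ centerOf S = N ∩ centerOf S → M = N)

/-- The algebra `S` has the centre-quotient property: every central element of a quotient
of `S` lifts to a central element of `S` modulo the ideal. -/
def HasCQ (S : Set R) : Prop :=
  ∀ I, IsIdealOf I S → ∀ a ∈ S, (∀ x ∈ S, a * x - x * a ∈ I) →
    ∃ z ∈ centerOf S, a - z ∈ I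

/-- `a` is a CQ-element of the algebra `S`. -/
def IsCQElem (S : Set R) (a : R) : Prop :=
  a ∈ S ∧ ∀ I, IsIdealOf I S → (∀ x ∈ S, a * x - x * a ∈ I) →
    ∃ z ∈ centerOf S, a - z ∈ I

/-- The set of CQ-elements of `S`. -/
def CQset (S : Set R) : Set R := {a | IsCQElem S a}

/-- The set `T_A` of modular maximal ideals witnessing the failure of weak centrality. -/
def Tset (S : Set R) : Set (Set R) :=
  {M | IsModMaxIdealOf M S ∧
    (centerOf S ⊆ M ∨ ∃ N, IsModMaxIdealOf N S ∧ N ≠ M ∧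
      ¬ centerOf S ⊆ M ∧ ¬ centerOf S ⊆ N ∧ M ∩ centerOf S = N ∩ centerOf S)}

/-- The closed two-sided ideal of `S` generated by the set `X`. -/
def genIdealOf (S X : Set R) : Set R := ⋂₀ {I | IsIdealOf I S ∧ X ⊆ I}

/-- The quotient `A/J` (of the full algebra by the ideal `J`) has the centre-quotient
property, expressed via the correspondence between ideals of `A/J` and ideals of `A`
containing `J`. -/
def HasCQmod (J : Set R) : Prop :=
  ∀ I : Set R, IsIdealOf I (Set.univ : Set R) → J ⊆ I → ∀ a : R,
    (∀ x : R, a * x - x * a ∈ I) →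
      ∃ z : R, (∀ x : R, z * x - x * z ∈ J) ∧ a - z ∈ I

end CQP

open CQP

/-- The largest weakly central ideal of the C*-algebra `S`. -/
def IsLargestWCIdealOf {R : Type*} [NonUnitalRing R] [TopologicalSpace R]
    (J S : Set R) : Prop :=
  IsIdealOf J S ∧ WeaklyCentral J ∧
    ∀ K : Set R, IsIdealOf K S → WeaklyCentral K → K ⊆ J

namespace CQP

/-- A continuous cutoff function which vanishes where `|x| ≤ t` and equals `1` where
`2 * t ≤ |x|`. -/
noncomputable def cutoff (t x : ℝ) : ℝ := min 1 (max (|x| - t) 0 / t)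

lemma continuous_cutoff (t : ℝ) : Continuous (cutoff t) := by
  unfold cutoff; fun_prop

lemma cutoff_nonneg {t : ℝ} (ht : 0 < t) (x : ℝ) : 0 ≤ cutoff t x :=
  le_min zero_le_one (by positivity)

lemma cutoff_le_one (t x : ℝ) : cutoff t x ≤ 1 := min_le_left _ _

lemma cutoff_eq_zero {t x : ℝ} (hx : |x| ≤ t) : cutoff t x = 0 := by
  simp [cutoff, max_eq_right (sub_nonpos.2 hx)]

lemma cutoff_eq_one {t x : ℝ} (ht : 0 < t) (hx : 2 * t ≤ |x|) : cutoff t x = 1 := by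
  refine min_eq_left ?_
  rw [one_le_div ht]
  exact le_max_of_le_left (by linarith)

lemma abs_mul_one_sub_cutoff_le {t : ℝ} (ht : 0 < t) (x : ℝ) :
    |x| * (1 - cutoff t x) ≤ 2 * t := by
  rcases le_total (2 * t) |x| with hx | hx
  · rw [cutoff_eq_one ht hx]; linarith
  · nlinarith [cutoff_nonneg ht x, cutoff_le_one t x, abs_nonneg x]

section Calculus

variable {A : Type*} [NonUnitalCStarAlgebra A]

/-- The cutoff function applied to a self-adjoint element. -/
noncomputable def cut (t : ℝ) (y : A) : A := cfcₙ (cutoff t) y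

lemma cut_isSelfAdjoint (t : ℝ) (y : A) : IsSelfAdjoint (cut t y) := cfcₙ_predicate _ _

lemma cut_commute {y b : A} (h : Commute y b) (t : ℝ) : Commute (cut t y) b := h.cfcₙ_real _

lemma norm_cut_le {t : ℝ} (ht : 0 < t) (y : A) : ‖cut t y‖ ≤ 1 :=
  norm_cfcₙ_le fun x _ ↦ by
    rw [Real.norm_of_nonneg (cutoff_nonneg ht x)]; exact cutoff_le_one t x

lemma cutoff_zero {t : ℝ} (ht : 0 < t) : cutoff t 0 = 0 := cutoff_eq_zero (by simpa using ht.le)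

lemma cut_half_mul_cut {t : ℝ} (ht : 0 < t) (y : A) : cut (t / 2) y * cut t y = cut t y := by
  rw [cut, cut, ← cfcₙ_mul (cutoff (t / 2)) (cutoff t) y
    (continuous_cutoff _).continuousOn (cutoff_zero (half_pos ht))
    (continuous_cutoff _).continuousOn (cutoff_zero ht)]
  congr 1
  ext x
  rcases le_total |x| t with hx | hx
  · simp [cutoff_eq_zero hx]
  · rw [cutoff_eq_one (half_pos ht) (by linarith), one_mul]

lemma sub_mul_cut {t : ℝ} (ht : 0 < t) {y : A} (hy : IsSelfAdjoint y) :
    y - y * cut t y = cfcₙ (fun x ↦ x - x * cutoff t x) y := by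
  have hc := continuous_cutoff t
  rw [cfcₙ_sub (fun x ↦ x) (fun x ↦ x * cutoff t x) y (by fun_prop) rfl
    (by fun_prop) (by simp), cfcₙ_mul (fun x ↦ x) (cutoff t) y (by fun_prop) rfl
    hc.continuousOn (cutoff_zero ht), cfcₙ_id' ℝ y, cut]

lemma norm_sub_mul_cut_le {t : ℝ} (ht : 0 < t) {y : A} (hy : IsSelfAdjoint y) :
    ‖y - y * cut t y‖ ≤ 2 * t := by
  rw [sub_mul_cut ht hy]
  refine norm_cfcₙ_le fun x _ ↦ ?_
  have : x - x * cutoff t x = x * (1 - cutoff t x) := by ring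
  rw [this, norm_mul, Real.norm_eq_abs,
    Real.norm_of_nonneg (sub_nonneg.2 (cutoff_le_one t x))]
  exact abs_mul_one_sub_cutoff_le ht x

lemma norm_sub_mul_cut_le_norm {t : ℝ} (ht : 0 < t) (a : A) {y : A} (hy : IsSelfAdjoint y) :
    ‖a - a * cut t y‖ ≤ ‖a‖ := by
  have hc := continuous_cutoff t
  have hy' : IsSelfAdjoint (y : Unitization ℂ A) := hy.inr ℂ
  have h1 : ‖(1 : Unitization ℂ A) - (cut t y : A)‖ ≤ 1 := by
    rw [cut, Unitization.real_cfcₙ_eq_cfc_inr y (cutoff t) (cutoff_zero ht),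
      ← cfc_const_one ℝ (y : Unitization ℂ A),
      ← cfc_sub (fun _ ↦ (1 : ℝ)) (cutoff t) (y : Unitization ℂ A) (by fun_prop)
        hc.continuousOn]
    refine norm_cfc_le zero_le_one fun x _ ↦ ?_
    rw [Real.norm_of_nonneg (sub_nonneg.2 (cutoff_le_one t x))]
    linarith [cutoff_nonneg ht x]
  rw [← Unitization.norm_inr (𝕜 := ℂ) (a - a * cut t y), ← Unitization.norm_inr (𝕜 := ℂ) a]
  have : ((a - a * cut t y : A) : Unitization ℂ A) = a * (1 - (cut t y : A)) := by
    rw [mul_sub, mul_one, Unitization.inr_sub, Unitization.inr_mul]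
  rw [this]
  exact (norm_mul_le _ _).trans (mul_le_of_le_one_right (norm_nonneg _) h1)

/-- An element `c` is approximately fixed by a cutoff of `star c * c`. -/
lemma norm_sub_mul_cut_star_mul_self_le {t : ℝ} (ht : 0 < t) (c : A) :
    ‖c - c * cut t (star c * c)‖ ^ 2 ≤ 2 * t := by
  set y := star c * c with hy
  have hsa : IsSelfAdjoint y := .star_mul_self c
  have hu := (cut_isSelfAdjoint t y).star_eq
  have : star (c - c * cut t y) * (c - c * cut t y)
      = (y - y * cut t y) - cut t y * (y - y * cut t y) := by
    rw [star_sub, star_mul, hu, hy]; noncomm_ring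
  rw [sq, ← CStarRing.norm_star_mul_self, this]
  have hcomm : Commute (cut t y) (y - y * cut t y) := by
    have h := cut_commute (Commute.refl y) t
    exact h.sub_right (h.mul_right (Commute.refl _))
  rw [hcomm.eq]
  exact (norm_sub_mul_cut_le_norm ht _ hsa).trans (norm_sub_mul_cut_le ht hsa)

lemma exists_cut_approx (c : A) {ε : ℝ} (hε : 0 < ε) :
    ∃ t > 0, ‖c - c * cut t (star c * c)‖ < ε := by
  refine ⟨ε ^ 2 / 4, by positivity, ?_⟩
  refine lt_of_pow_lt_pow_left₀ 2 hε.le ?_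
  have := norm_sub_mul_cut_star_mul_self_le (t := ε ^ 2 / 4) (by positivity) c
  nlinarith [pow_pos hε 2]

/-- Functions vanishing near zero are divisible by the coordinate. -/
lemma cfcₙ_eq_mul_self {f : ℝ → ℝ} (hf : Continuous f) {t : ℝ} (ht : 0 < t)
    (h0 : ∀ x, |x| ≤ t → f x = 0) {y : A} (hy : IsSelfAdjoint y) :
    cfcₙ f y = cfcₙ (fun x ↦ f x * (x / (max |x| t) ^ 2)) y * y := by
  have hm : ∀ x : ℝ, 0 < max |x| t := fun x ↦ lt_max_of_lt_right ht
  have hc : Continuous (fun x : ℝ ↦ f x * (x / (max |x| t) ^ 2)) :=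
    hf.mul (continuous_id.div (by fun_prop) fun x ↦ (pow_pos (hm x) 2).ne')
  conv_rhs => enter [2]; rw [← cfcₙ_id' ℝ y]
  rw [← cfcₙ_mul _ _ y hc.continuousOn (by simp) (by fun_prop) rfl]
  congr 1
  ext x
  rcases le_total |x| t with hx | hx
  · simp [h0 x hx]
  · have hx0 : x ≠ 0 := fun h ↦ by simp [h] at hx; linarith
    rw [max_eq_left hx, sq_abs]
    field_simp

end Calculus

end CQP

namespace CQP

namespace IsIdealOf

section Ring

variable {R : Type*} [NonUnitalRing R] [TopologicalSpace R] {I J S : Set R} {x y a : R}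

lemma subset (h : IsIdealOf I S) : I ⊆ S := h.1

lemma isClosed (h : IsIdealOf I S) : IsClosed I := h.2.1

lemma zero_mem (h : IsIdealOf I S) : (0 : R) ∈ I := h.2.2.1

lemma add_mem (h : IsIdealOf I S) (hx : x ∈ I) (hy : y ∈ I) : x + y ∈ I := h.2.2.2.1 x hx y hy

lemma neg_mem (h : IsIdealOf I S) (hx : x ∈ I) : -x ∈ I := h.2.2.2.2.1 x hx

lemma sub_mem (h : IsIdealOf I S) (hx : x ∈ I) (hy : y ∈ I) : x - y ∈ I :=
  sub_eq_add_neg x y ▸ h.add_mem hx (h.neg_mem hy)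

lemma mul_mem_left (h : IsIdealOf I S) (ha : a ∈ S) (hx : x ∈ I) : a * x ∈ I :=
  (h.2.2.2.2.2 x hx a ha).1

lemma mul_mem_right (h : IsIdealOf I S) (hx : x ∈ I) (ha : a ∈ S) : x * a ∈ I :=
  (h.2.2.2.2.2 x hx a ha).2

lemma mem_of_sub_mem (h : IsIdealOf I S) (hxy : x - y ∈ I) (hy : y ∈ I) : x ∈ I := by
  simpa using h.add_mem hxy hy

lemma inter (hI : IsIdealOf I S) (hJ : IsIdealOf J S) : IsIdealOf (I ∩ J) S :=
  ⟨fun _ h ↦ hI.subset h.1, hI.isClosed.inter hJ.isClosed, ⟨hI.zero_mem, hJ.zero_mem⟩,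
    fun _ hx _ hy ↦ ⟨hI.add_mem hx.1 hy.1, hJ.add_mem hx.2 hy.2⟩,
    fun _ hx ↦ ⟨hI.neg_mem hx.1, hJ.neg_mem hx.2⟩,
    fun _ hx _ ha ↦ ⟨⟨hI.mul_mem_left ha hx.1, hJ.mul_mem_left ha hx.2⟩,
      ⟨hI.mul_mem_right hx.1 ha, hJ.mul_mem_right hx.2 ha⟩⟩⟩

lemma of_subset {T : Set R} (hI : IsIdealOf I S) (hIT : I ⊆ T) (hTS : T ⊆ S) : IsIdealOf I T :=
  ⟨hIT, hI.isClosed, hI.zero_mem, fun _ hx _ hy ↦ hI.add_mem hx hy, fun _ hx ↦ hI.neg_mem hx,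
    fun _ hx _ ha ↦ ⟨hI.mul_mem_left (hTS ha) hx, hI.mul_mem_right hx (hTS ha)⟩⟩

end Ring

variable {A : Type*} [NonUnitalCStarAlgebra A] {L M S J K₁ K₂ : Set A}

lemma mem_of_forall_norm_le (hL : IsIdealOf L S) {x : A}
    (h : ∀ ε > 0, ∃ y ∈ L, ‖x - y‖ ≤ ε) : x ∈ L := by
  rw [← hL.isClosed.closure_eq, Metric.mem_closure_iff]
  intro ε hε
  obtain ⟨y, hy, hxy⟩ := h (ε / 2) (by positivity)
  exact ⟨y, hy, by rw [dist_eq_norm]; linarith⟩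

lemma cfcₙ_mem (hS : IsIdealOf S Set.univ) {f : ℝ → ℝ} (hf : Continuous f) {t : ℝ} (ht : 0 < t)
    (h0 : ∀ x, |x| ≤ t → f x = 0) {y : A} (hy : IsSelfAdjoint y) (hyS : y ∈ S) :
    cfcₙ f y ∈ S := by
  rw [cfcₙ_eq_mul_self hf ht h0 hy]
  exact hS.mul_mem_left trivial hyS

lemma cut_mem (hS : IsIdealOf S Set.univ) {t : ℝ} (ht : 0 < t) {y : A} (hy : IsSelfAdjoint y)
    (hyS : y ∈ S) : cut t y ∈ S :=
  hS.cfcₙ_mem (continuous_cutoff t) ht (fun _ ↦ cutoff_eq_zero) hy hyS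

lemma star_mem (hS : IsIdealOf S Set.univ) {x : A} (hx : x ∈ S) : star x ∈ S := by
  refine hS.mem_of_forall_norm_le fun ε hε ↦ ?_
  obtain ⟨t, ht, h⟩ := exists_cut_approx x hε
  refine ⟨cut t (star x * x) * star x, hS.mul_mem_right
    (hS.cut_mem ht (.star_mul_self x) (hS.mul_mem_left trivial hx)) trivial, ?_⟩
  rw [← norm_star]
  simpa [(cut_isSelfAdjoint t (star x * x)).star_eq] using h.le

/-- A closed ideal of a closed ideal is a closed ideal of the whole algebra. -/
lemma trans (hJ : IsIdealOf J S) (hS : IsIdealOf S Set.univ) : IsIdealOf J Set.univ := by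
  have key : ∀ x ∈ J, ∀ ε > 0, ∃ u ∈ J, IsSelfAdjoint u ∧ ‖x - x * u‖ < ε := by
    intro x hx ε hε
    obtain ⟨t, ht, h⟩ := exists_cut_approx x hε
    have hyJ : star x * x ∈ J := hJ.mul_mem_left (hS.star_mem (hJ.subset hx)) hx
    refine ⟨cut t (star x * x), ?_, cut_isSelfAdjoint _ _, h⟩
    have hm : ∀ r : ℝ, 0 < max |r| t := fun r ↦ lt_max_of_lt_right ht
    rw [cut, cfcₙ_eq_mul_self (continuous_cutoff t) ht (fun _ ↦ cutoff_eq_zero)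
      (.star_mul_self x)]
    refine hJ.mul_mem_left (hS.cfcₙ_mem ?_ ht ?_ (.star_mul_self x) (hJ.subset hyJ)) hyJ
    · exact (continuous_cutoff t).mul
        (continuous_id.div (by fun_prop) fun r ↦ (pow_pos (hm r) 2).ne')
    · intro r hr
      simp [cutoff_eq_zero hr]
  have hright : ∀ x ∈ J, ∀ a : A, a * x ∈ J := by
    intro x hx a
    refine hJ.mem_of_forall_norm_le fun ε hε ↦ ?_
    obtain ⟨u, hu, -, h⟩ := key x hx (ε / (‖a‖ + 1)) (by positivity)
    refine ⟨a * x * u, hJ.mul_mem_left (hS.mul_mem_left trivial (hJ.subset hx)) hu, ?_⟩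
    rw [mul_assoc, ← mul_sub]
    refine (norm_mul_le _ _).trans ?_
    rw [lt_div_iff₀ (by positivity)] at h
    nlinarith [norm_nonneg a, norm_nonneg (x - x * u)]
  have hstar : ∀ x ∈ J, star x ∈ J := by
    intro x hx
    refine hJ.mem_of_forall_norm_le fun ε hε ↦ ?_
    obtain ⟨u, hu, hsa, h⟩ := key x hx ε hε
    refine ⟨u * star x, hJ.mul_mem_right hu (hS.star_mem (hJ.subset hx)), ?_⟩
    rw [← norm_star]
    simpa [hsa.star_eq] using h.le
  refine ⟨Set.subset_univ _, hJ.isClosed, hJ.zero_mem, fun _ hx _ hy ↦ hJ.add_mem hx hy,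
    fun _ hx ↦ hJ.neg_mem hx, fun x hx a _ ↦ ⟨hright x hx a, ?_⟩⟩
  simpa using hstar _ (hright _ (hstar x hx) (star a))

/-- If `y` is within distance `δ < t` of a closed ideal, then functions of `y` vanishing on
`[-t, t]` are in the ideal. -/
lemma cut_mem_of_norm_sub_lt (hL : IsIdealOf L Set.univ) {t : ℝ} (ht : 0 < t) {y l : A}
    (hy : IsSelfAdjoint y) (hl : l ∈ L) (hlt : ‖y - l‖ < t) : cut t y ∈ L := by
  have hm : ∀ x : ℝ, 0 < max |x| t := fun x ↦ lt_max_of_lt_right ht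
  have key : ∀ n : ℕ, ∀ f : ℝ → ℝ, ∀ C : ℝ, Continuous f → (∀ x, |x| ≤ t → f x = 0) →
      (∀ x, |f x| ≤ C) → ∃ l' ∈ L, ‖cfcₙ f y - l'‖ ≤ C * (‖y - l‖ / t) ^ n := by
    intro n
    induction n with
    | zero =>
      intro f C _ _ hC
      exact ⟨0, hL.zero_mem, by simpa using norm_cfcₙ_le fun x _ ↦ hC x⟩
    | succ n ih =>
      intro f C hf h0 hC
      obtain ⟨l₁, hl₁, h⟩ := ih (fun x ↦ f x * (x / (max |x| t) ^ 2)) (C / t)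
        (hf.mul (continuous_id.div (by fun_prop) fun x ↦ (pow_pos (hm x) 2).ne'))
        (fun x hx ↦ by simp [h0 x hx]) (fun x ↦ by
          rw [abs_mul, div_eq_mul_one_div C t]
          refine mul_le_mul (hC x) ?_ (abs_nonneg _) ((abs_nonneg _).trans (hC x))
          rw [abs_div, abs_of_pos (pow_pos (hm x) 2), div_le_div_iff₀ (pow_pos (hm x) 2) ht]
          nlinarith [le_max_left |x| t, le_max_right |x| t, abs_nonneg x])
      set b := cfcₙ (fun x ↦ f x * (x / (max |x| t) ^ 2)) y with hb
      refine ⟨b * l + l₁ * y - l₁ * l, hL.sub_mem (hL.add_mem (hL.mul_mem_left trivial hl)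
        (hL.mul_mem_right hl₁ trivial)) (hL.mul_mem_left trivial hl), ?_⟩
      have : cfcₙ f y - (b * l + l₁ * y - l₁ * l) = (b - l₁) * (y - l) := by
        rw [cfcₙ_eq_mul_self hf ht h0 hy, ← hb]; noncomm_ring
      rw [this]
      calc ‖(b - l₁) * (y - l)‖ ≤ ‖b - l₁‖ * ‖y - l‖ := norm_mul_le _ _
        _ ≤ C / t * (‖y - l‖ / t) ^ n * ‖y - l‖ := by gcongr
        _ = C * (‖y - l‖ / t) ^ (n + 1) := by rw [pow_succ]; ring
  refine hL.mem_of_forall_norm_le fun ε hε ↦ ?_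
  obtain ⟨n, hn⟩ := exists_pow_lt_of_lt_one hε ((div_lt_one ht).2 hlt)
  obtain ⟨l', hl', h⟩ := key n (cutoff t) 1 (continuous_cutoff t) (fun _ ↦ cutoff_eq_zero)
    (fun x ↦ by rw [abs_of_nonneg (cutoff_nonneg ht x)]; exact cutoff_le_one t x)
  exact ⟨l', hl', by rw [one_mul] at h; exact h.trans hn.le⟩

/-- An element which is idempotent modulo a closed ideal and has quotient norm less than one
belongs to the ideal. -/
lemma mem_of_idempotent_of_norm_sub_lt_one (hL : IsIdealOf L S) {z l : A} (hz : z ∈ S)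
    (hzz : z - z * z ∈ L) (hl : l ∈ L) (hlt : ‖z - l‖ < 1) : z ∈ L := by
  have key : ∀ n : ℕ, ∃ l' ∈ L, ‖z - l'‖ ≤ ‖z - l‖ ^ (n + 1) := by
    intro n
    induction n with
    | zero => exact ⟨l, hl, by simp⟩
    | succ n ih =>
      obtain ⟨l₁, hl₁, h⟩ := ih
      refine ⟨(z - z * z) + (z * l + l₁ * z - l₁ * l), hL.add_mem hzz
        (hL.sub_mem (hL.add_mem (hL.mul_mem_left hz hl) (hL.mul_mem_right hl₁ hz))
          (hL.mul_mem_left (hL.subset hl₁) hl)), ?_⟩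
      have : z - ((z - z * z) + (z * l + l₁ * z - l₁ * l)) = (z - l₁) * (z - l) := by
        noncomm_ring
      rw [this, pow_succ]
      exact (norm_mul_le _ _).trans (by gcongr)
  refine hL.mem_of_forall_norm_le fun ε hε ↦ ?_
  obtain ⟨n, hn⟩ := exists_pow_lt_of_lt_one hε hlt
  obtain ⟨l', hl', h⟩ := key n
  refine ⟨l', hl', h.trans (le_trans ?_ hn.le)⟩
  exact pow_le_pow_of_le_one (norm_nonneg _) hlt.le n.le_succ

/-- The underlying additive subgroup of a closed ideal. -/
def toAddSubgroup (h : IsIdealOf L S) : AddSubgroup A where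
  carrier := L
  zero_mem' := h.zero_mem
  add_mem' := h.add_mem
  neg_mem' := h.neg_mem

/-- The sum of two closed ideals is a closed ideal. -/
lemma add (h₁ : IsIdealOf K₁ Set.univ) (h₂ : IsIdealOf K₂ Set.univ) :
    IsIdealOf (K₁ + K₂) (Set.univ : Set A) := by
  refine ⟨Set.subset_univ _, ?_, ⟨0, h₁.zero_mem, 0, h₂.zero_mem, add_zero 0⟩, ?_, ?_, ?_⟩
  · let G₁ := h₁.toAddSubgroup
    let G₂ := h₂.toAddSubgroup
    have hc₁ : CompleteSpace G₁ := h₁.isClosed.completeSpace_coe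
    have hc₂ : CompleteSpace G₂ := h₂.isClosed.completeSpace_coe
    let f : NormedAddGroupHom (G₁ × G₂) A := AddMonoidHom.mkNormedAddGroupHom
      ((G₁.subtype).coprod G₂.subtype) 2 (fun p ↦ by
        have h1 : ‖(p.1 : A)‖ ≤ ‖p‖ := norm_fst_le p
        have h2 : ‖(p.2 : A)‖ ≤ ‖p‖ := norm_snd_le p
        calc ‖(p.1 : A) + p.2‖ ≤ ‖(p.1 : A)‖ + ‖(p.2 : A)‖ := norm_add_le _ _
          _ ≤ 2 * ‖p‖ := by linarith)
    have hf : ∀ p, f p = (p.1 : A) + p.2 := fun _ ↦ rfl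
    have hrange : ((G₁ ⊔ G₂ : AddSubgroup A) : Set A) = K₁ + K₂ := by
      rw [AddSubgroup.add_normal]; rfl
    have hsurj : f.SurjectiveOnWith (G₁ ⊔ G₂) 3 := by
      intro x hx
      rw [← SetLike.mem_coe, hrange] at hx
      obtain ⟨a, ha, b, hb, rfl⟩ := hx
      dsimp only
      rcases eq_or_ne (a + b) 0 with hab | hab
      · exact ⟨0, by simp [hab], by simp⟩
      obtain ⟨t, ht, hta⟩ := exists_cut_approx (star a) (norm_pos_iff.2 hab)
      set u := cut t (star (star a) * star a) with hu
      have husa : IsSelfAdjoint u := cut_isSelfAdjoint _ _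
      have hu1 : ‖u‖ ≤ 1 := norm_cut_le ht _
      have huK : u ∈ K₁ := h₁.cut_mem ht (.star_mul_self _)
        (h₁.mul_mem_left trivial (h₁.star_mem ha))
      have hta' : ‖a - u * a‖ < ‖a + b‖ := by
        rw [← norm_star]; simpa [husa.star_eq] using hta
      have ha' : u * (a + b) + (a - u * a) ∈ K₁ := h₁.add_mem (h₁.mul_mem_right huK trivial)
        (h₁.sub_mem ha (h₁.mul_mem_left trivial ha))
      have hb' : b - u * b ∈ K₂ := h₂.sub_mem hb (h₂.mul_mem_left trivial hb)
      have hsum : u * (a + b) + (a - u * a) + (b - u * b) = a + b := by noncomm_ring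
      have hna : ‖u * (a + b) + (a - u * a)‖ ≤ 2 * ‖a + b‖ := by
        have := norm_add_le (u * (a + b)) (a - u * a)
        have := norm_mul_le u (a + b)
        nlinarith [norm_nonneg (a + b)]
      have hnb : ‖b - u * b‖ ≤ 3 * ‖a + b‖ := by
        have : b - u * b = (a + b) - (u * (a + b) + (a - u * a)) := by noncomm_ring
        rw [this]
        have := norm_sub_le (a + b) (u * (a + b) + (a - u * a))
        linarith
      refine ⟨(⟨_, ha'⟩, ⟨_, hb'⟩), hsum, ?_⟩
      exact max_le (hna.trans (by nlinarith [norm_nonneg (a + b)])) hnb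
    have hcl := controlled_closure_of_complete three_pos one_pos hsurj
    refine isClosed_of_closure_subset fun x hx ↦ ?_
    rw [← hrange] at hx
    obtain ⟨p, hp, -⟩ := hcl x hx
    exact ⟨p.1, p.1.2, p.2, p.2.2, hp⟩
  · rintro _ ⟨a, ha, b, hb, rfl⟩ _ ⟨c, hc, d, hd, rfl⟩
    exact ⟨a + c, h₁.add_mem ha hc, b + d, h₂.add_mem hb hd, add_add_add_comm a c b d⟩
  · rintro _ ⟨a, ha, b, hb, rfl⟩
    exact ⟨-a, h₁.neg_mem ha, -b, h₂.neg_mem hb, (neg_add a b).symm⟩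
  · rintro _ ⟨a, ha, b, hb, rfl⟩ c -
    exact ⟨⟨c * a, h₁.mul_mem_left trivial ha, c * b, h₂.mul_mem_left trivial hb,
        (mul_add c a b).symm⟩,
      ⟨a * c, h₁.mul_mem_right ha trivial, b * c, h₂.mul_mem_right hb trivial,
        (add_mul a b c).symm⟩⟩

end IsIdealOf

end CQP

namespace CQP

section Center

variable {A : Type*} [NonUnitalCStarAlgebra A] {S K : Set A} {z w : A}

/-- The centre of a closed ideal consists of elements commuting with the whole algebra. -/
lemma mem_centerOf_iff (hS : IsIdealOf S Set.univ) :
    z ∈ centerOf S ↔ z ∈ S ∧ ∀ a, Commute z a := by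
  refine ⟨fun ⟨hz, h⟩ ↦ ⟨hz, fun a ↦ ?_⟩, fun ⟨hz, h⟩ ↦ ⟨hz, fun x _ ↦ h x⟩⟩
  have hd : z * a - a * z ∈ S :=
    hS.sub_mem (hS.mul_mem_right hz trivial) (hS.mul_mem_left trivial hz)
  have key : ∀ k ∈ S, (z * a - a * z) * k = 0 := by
    intro k hk
    rw [sub_mul, mul_assoc, h _ (hS.mul_mem_left trivial hk), mul_assoc a z k, h k hk,
      mul_assoc, sub_self]
  exact sub_eq_zero.1 (CStarRing.mul_star_self_eq_zero_iff _ |>.1 (key _ (hS.star_mem hd)))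

lemma centerOf_subset_centerOf (hK : IsIdealOf K Set.univ) (hS : IsIdealOf S Set.univ)
    (hKS : K ⊆ S) : centerOf K ⊆ centerOf S := fun _ hz ↦
  (mem_centerOf_iff hS).2 ⟨hKS hz.1, ((mem_centerOf_iff hK).1 hz).2⟩

lemma star_mem_centerOf (hS : IsIdealOf S Set.univ) (hz : z ∈ centerOf S) :
    star z ∈ centerOf S := by
  rw [mem_centerOf_iff hS] at hz ⊢
  exact ⟨hS.star_mem hz.1, fun a ↦ by simpa using (hz.2 (star a)).star_star⟩

lemma mul_mem_centerOf (hS : IsIdealOf S Set.univ) (hz : z ∈ centerOf S) (hw : w ∈ centerOf S) :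
    z * w ∈ centerOf S := by
  rw [mem_centerOf_iff hS] at hz hw ⊢
  exact ⟨hS.mul_mem_left trivial hw.1, fun a ↦ (hz.2 a).mul_left (hw.2 a)⟩

lemma sub_mem_centerOf (hS : IsIdealOf S Set.univ) (hz : z ∈ centerOf S) (hw : w ∈ centerOf S) :
    z - w ∈ centerOf S := by
  rw [mem_centerOf_iff hS] at hz hw ⊢
  exact ⟨hS.sub_mem hz.1 hw.1, fun a ↦ (hz.2 a).sub_left (hw.2 a)⟩

lemma cut_mem_centerOf (hS : IsIdealOf S Set.univ) {t : ℝ} (ht : 0 < t) (hsa : IsSelfAdjoint z)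
    (hz : z ∈ centerOf S) : cut t z ∈ centerOf S := by
  rw [mem_centerOf_iff hS] at hz ⊢
  exact ⟨hS.cut_mem ht hsa hz.1, fun a ↦ cut_commute (hz.2 a) t⟩

end Center

namespace IsModMaxIdealOf

variable {A : Type*} [NonUnitalCStarAlgebra A] {M N S J K : Set A}

lemma eq_of_subset (hM : IsModMaxIdealOf M S) (hN : IsIdealOf N S) (hMN : M ⊆ N) (hNS : N ≠ S) :
    N = M := (hM.2.2.1 N hN hMN).resolve_right hNS

/-- Modular maximal ideals are prime with respect to central elements. -/
lemma mem_of_mul_mem (hS : IsIdealOf S Set.univ) (hM : IsModMaxIdealOf M S) {a b : A}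
    (ha : a ∈ S) (hb : b ∈ centerOf S) (hab : a * b ∈ M) (hbM : b ∉ M) : a ∈ M := by
  obtain ⟨hMS, -, hmax, e, heS, he⟩ := hM
  have hbc := ((mem_centerOf_iff hS).1 hb).2
  have hI : IsIdealOf {x ∈ S | x * b ∈ M} S := by
    refine ⟨fun _ h ↦ h.1, hS.isClosed.inter (hMS.isClosed.preimage (by fun_prop)),
      ⟨hS.zero_mem, by simpa using hMS.zero_mem⟩, fun x hx y hy ↦ ⟨hS.add_mem hx.1 hy.1, ?_⟩,
      fun x hx ↦ ⟨hS.neg_mem hx.1, ?_⟩, fun x hx c hc ↦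
        ⟨⟨hS.mul_mem_left trivial hx.1, ?_⟩, ⟨hS.mul_mem_left trivial hc, ?_⟩⟩⟩
    · rw [add_mul]; exact hMS.add_mem hx.2 hy.2
    · rw [neg_mul]; exact hMS.neg_mem hx.2
    · rw [mul_assoc]; exact hMS.mul_mem_left hc hx.2
    · rw [mul_assoc, ← (hbc c).eq, ← mul_assoc]; exact hMS.mul_mem_right hx.2 hc
  rcases hmax _ hI fun x hx ↦ ⟨hMS.subset hx, hMS.mul_mem_right hx hb.1⟩ with h | h
  · rw [← h]; exact ⟨ha, hab⟩
  · have h' : e * b ∈ M := (h.symm ▸ heS : e ∈ {x ∈ S | x * b ∈ M}).2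
    exact absurd (hMS.mem_of_sub_mem (he b hb.1).2 h') hbM

/-- A central element outside a modular maximal ideal has a self-adjoint central function which
acts as an identity modulo the ideal. -/
lemma exists_cut (hS : IsIdealOf S Set.univ) (hM : IsModMaxIdealOf M S) {n : A}
    (hn : n ∈ centerOf S) (hnM : n ∉ M) :
    ∃ t > 0, cut t (star n * n) ∉ M ∧
      ∀ s ∈ centerOf S, s - s * cut (t / 2) (star n * n) ∈ M := by
  have hMA := hM.1.trans hS
  set y := star n * n with hy
  have hsa : IsSelfAdjoint y := .star_mul_self n
  have hyS : y ∈ centerOf S := mul_mem_centerOf hS (star_mem_centerOf hS hn) hn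
  obtain ⟨t, ht, htM⟩ : ∃ t > 0, cut t y ∉ M := by
    by_contra! h
    refine hnM (hMA.mem_of_forall_norm_le fun ε hε ↦ ?_)
    obtain ⟨t, ht, h'⟩ := exists_cut_approx n hε
    exact ⟨_, hMA.mul_mem_left trivial (h t ht), h'.le⟩
  refine ⟨t, ht, htM, fun s hs ↦ ?_⟩
  refine hM.mem_of_mul_mem hS ?_ (cut_mem_centerOf hS ht hsa hyS) ?_ htM
  · exact hS.sub_mem hs.1 (hS.mul_mem_right hs.1 trivial)
  · rw [sub_mul, mul_assoc, cut_half_mul_cut ht, sub_self]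
    exact hM.1.zero_mem

/-- A modular maximal ideal of a closed ideal `J ⊆ S` extends to one of `S`. -/
lemma exists_extension (hS : IsIdealOf S Set.univ) (hJ : IsIdealOf J Set.univ) (hJS : J ⊆ S)
    (hM : IsModMaxIdealOf M J) : ∃ N, IsModMaxIdealOf N S ∧ N ∩ J = M := by
  have hMA := hM.1.trans hJ
  obtain ⟨hMJ, hne, hmax, e, heJ, he⟩ := hM
  set N : Set A := {a ∈ S | ∀ x ∈ J, a * x ∈ M} with hN
  have hNJ : N ∩ J = M := by
    refine Set.Subset.antisymm (fun a ha ↦ hMJ.mem_of_sub_mem (he a ha.2).1 (ha.1.2 e heJ))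
      fun a ha ↦ ⟨⟨hJS (hMJ.subset ha), fun x hx ↦ hMJ.mul_mem_right ha hx⟩, hMJ.subset ha⟩
  have hNS : IsIdealOf N S := by
    refine ⟨fun _ h ↦ h.1, ?_, ⟨hS.zero_mem, fun x _ ↦ by simpa using hMJ.zero_mem⟩,
      fun x hx y hy ↦ ⟨hS.add_mem hx.1 hy.1, fun k hk ↦ ?_⟩,
      fun x hx ↦ ⟨hS.neg_mem hx.1, fun k hk ↦ ?_⟩, fun x hx c hc ↦
        ⟨⟨hS.mul_mem_left trivial hx.1, fun k hk ↦ ?_⟩,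
          ⟨hS.mul_mem_left trivial hc, fun k hk ↦ ?_⟩⟩⟩
    · have : N = S ∩ ⋂ x ∈ J, (fun a ↦ a * x) ⁻¹' M := by ext; simp [hN]
      rw [this]
      exact hS.isClosed.inter (isClosed_biInter fun x _ ↦ hMJ.isClosed.preimage (by fun_prop))
    · rw [add_mul]; exact hMJ.add_mem (hx.2 k hk) (hy.2 k hk)
    · rw [neg_mul]; exact hMJ.neg_mem (hx.2 k hk)
    · rw [mul_assoc]; exact hMA.mul_mem_left trivial (hx.2 k hk)
    · rw [mul_assoc]; exact hx.2 _ (hJ.mul_mem_left trivial hk)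
  have hunit : ∀ s ∈ S, s - s * e ∈ N ∧ s - e * s ∈ N := by
    refine fun s hs ↦ ⟨⟨hS.sub_mem hs (hS.mul_mem_right hs trivial), fun x hx ↦ ?_⟩,
      ⟨hS.sub_mem hs (hS.mul_mem_left trivial hs), fun x hx ↦ ?_⟩⟩
    · rw [sub_mul, mul_assoc, ← mul_sub]
      exact hMA.mul_mem_left trivial (he x hx).2
    · rw [sub_mul, mul_assoc]
      exact (he _ (hJ.mul_mem_left trivial hx)).2
  refine ⟨N, ⟨hNS, fun h ↦ hne ?_, fun L hL hNL ↦ ?_, e, hJS heJ, hunit⟩, hNJ⟩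
  · rw [← hNJ, h, Set.inter_eq_right.2 hJS]
  · have hLA := hL.trans hS
    have hLJ : IsIdealOf (L ∩ J) J :=
      (hLA.inter hJ).of_subset Set.inter_subset_right (Set.subset_univ _)
    rcases hmax _ hLJ (hNJ ▸ Set.inter_subset_inter_left _ hNL) with h | h
    · left
      refine Set.Subset.antisymm (fun a ha ↦ ⟨hL.subset ha, fun x hx ↦ ?_⟩) hNL
      rw [← h]
      exact ⟨hLA.mul_mem_right ha trivial, hJ.mul_mem_left trivial hx⟩
    · right
      have heL : e ∈ L := (h.symm ▸ heJ : e ∈ L ∩ J).1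
      exact Set.Subset.antisymm hL.subset fun s hs ↦
        hL.mem_of_sub_mem (hNL (hunit s hs).1) (hL.mul_mem_left hs heL)

/-- A modular maximal ideal together with an ideal it does not contain spans everything. -/
lemma add_eq (hS : IsIdealOf S Set.univ) (hM : IsModMaxIdealOf M S) (hK : IsIdealOf K Set.univ)
    (hKS : K ⊆ S) (hKM : ¬ K ⊆ M) : M + K = S := by
  have hMA := hM.1.trans hS
  have hsub : M + K ⊆ S := by
    rintro _ ⟨m, hm, k, hk, rfl⟩
    exact hS.add_mem (hM.1.subset hm) (hKS hk)
  have hI := (hMA.add hK).of_subset hsub (Set.subset_univ _)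
  refine (hM.2.2.1 _ hI fun m hm ↦ ⟨m, hm, 0, hK.zero_mem, add_zero m⟩).resolve_left fun h ↦ ?_
  exact hKM fun k hk ↦ h ▸ ⟨0, hM.1.zero_mem, k, hk, zero_add k⟩

/-- A modular maximal ideal restricts to one of every closed ideal which it does not contain. -/
lemma inter (hS : IsIdealOf S Set.univ) (hM : IsModMaxIdealOf M S) (hK : IsIdealOf K Set.univ)
    (hKS : K ⊆ S) (hKM : ¬ K ⊆ M) : IsModMaxIdealOf (M ∩ K) K := by
  have hMA := hM.1.trans hS
  have hadd := hM.add_eq hS hK hKS hKM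
  refine ⟨(hMA.inter hK).of_subset Set.inter_subset_right (Set.subset_univ _),
    fun h ↦ hKM (Set.inter_eq_right.1 h), fun I hI hMI ↦ ?_, ?_⟩
  · have hIA := hI.trans hK
    by_cases hIM : I ⊆ M
    · exact .inl (Set.Subset.antisymm (fun x hx ↦ ⟨hIM hx, hI.subset hx⟩) hMI)
    · right
      refine Set.Subset.antisymm hI.subset fun k hk ↦ ?_
      have hk' : k ∈ M + I := hM.add_eq hS hIA (hI.subset.trans hKS) hIM ▸ hKS hk
      obtain ⟨m, hm, i, hi, rfl⟩ := hk'
      have hmK : m ∈ K := by simpa using hK.sub_mem hk (hI.subset hi)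
      exact hI.add_mem (hMI ⟨hm, hmK⟩) hi
  · obtain ⟨e, heS, he⟩ := hM.2.2.2
    have he' : e ∈ M + K := hadd ▸ heS
    obtain ⟨m, hm, k, hk, rfl⟩ := he'
    refine ⟨k, hk, fun x hx ↦ ⟨⟨?_, hK.sub_mem hx (hK.mul_mem_left trivial hk)⟩,
      ⟨?_, hK.sub_mem hx (hK.mul_mem_left trivial hx)⟩⟩⟩
    · have : x - x * k = (x - x * (m + k)) + x * m := by noncomm_ring
      rw [this]
      exact hMA.add_mem (he x (hKS hx)).1 (hMA.mul_mem_left trivial hm)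
    · have : x - k * x = (x - (m + k) * x) + m * x := by noncomm_ring
      rw [this]
      exact hMA.add_mem (he x (hKS hx)).2 (hMA.mul_mem_right hm trivial)

/-- A modular maximal ideal is determined by its intersection with any closed ideal which it
does not contain. -/
lemma eq_of_inter_eq (hS : IsIdealOf S Set.univ) (hM : IsModMaxIdealOf M S)
    (hN : IsModMaxIdealOf N S) (hK : IsIdealOf K Set.univ) (hKS : K ⊆ S) (hKM : ¬ K ⊆ M)
    (h : M ∩ K = N ∩ K) : M = N := by
  have hMA := hM.1.trans hS
  have hNA := hN.1.trans hS
  refine hN.eq_of_subset hM.1 (fun n hn ↦ ?_) hM.2.1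
  obtain ⟨e, heS, he⟩ := hM.2.2.2
  have he' : e ∈ M + K := hM.add_eq hS hK hKS hKM ▸ heS
  obtain ⟨m, hm, k, hk, rfl⟩ := he'
  refine hMA.mem_of_sub_mem (he n (hN.1.subset hn)).1 ?_
  rw [mul_add]
  refine hMA.add_mem (hMA.mul_mem_left trivial hm) ?_
  have : n * k ∈ N ∩ K := ⟨hNA.mul_mem_right hn trivial, hK.mul_mem_left trivial hk⟩
  exact (h ▸ this : n * k ∈ M ∩ K).1

end IsModMaxIdealOf

end CQP

namespace CQP

section Main

variable {A : Type*} [NonUnitalCStarAlgebra A] {M S J K : Set A}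

/-- The self-adjoint central contractions of `S` congruent to `z` modulo `M`. -/
def centralUnits (S M : Set A) (z : A) : Set A :=
  {g | g ∈ centerOf S ∧ IsSelfAdjoint g ∧ ‖g‖ ≤ 1 ∧ g - z ∈ M}

lemma mul_mem_centralUnits (hS : IsIdealOf S Set.univ) (hM : IsIdealOf M Set.univ) {z g h : A}
    (hzz : z - z * z ∈ M) (hg : g ∈ centralUnits S M z) (hh : h ∈ centralUnits S M z) :
    g * h ∈ centralUnits S M z := by
  obtain ⟨hgc, hgs, hg1, hgz⟩ := hg
  obtain ⟨hhc, hhs, hh1, hhz⟩ := hh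
  refine ⟨mul_mem_centerOf hS hgc hhc,
    (hgs.commute_iff hhs).1 (((mem_centerOf_iff hS).1 hgc).2 h),
    (norm_mul_le _ _).trans (mul_le_one₀ hg1 (norm_nonneg _) hh1), ?_⟩
  have : g * h - z = g * (h - z) + (g - z) * z - (z - z * z) := by noncomm_ring
  rw [this]
  exact hM.sub_mem (hM.add_mem (hM.mul_mem_left trivial hhz) (hM.mul_mem_right hgz trivial)) hzz

/-- The elements of `S` which are locally in `J` near the point `M` of the centre of `S`. -/
def localIdeal (S M J : Set A) (z : A) : Set A :=
  {x ∈ S | ∀ ε > 0, ∃ g ∈ centralUnits S M z, ∃ j ∈ J, ‖g * x - j‖ ≤ ε}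

lemma isIdealOf_localIdeal (hS : IsIdealOf S Set.univ) (hM : IsIdealOf M Set.univ)
    (hJ : IsIdealOf J Set.univ) {z : A} (hz : z ∈ centralUnits S M z) (hzz : z - z * z ∈ M) :
    IsIdealOf (localIdeal S M J z) S := by
  refine ⟨fun _ h ↦ h.1, isClosed_of_closure_subset fun x hx ↦ ?_,
    ⟨hS.zero_mem, fun ε hε ↦ ⟨z, hz, 0, hJ.zero_mem, by simpa using hε.le⟩⟩,
    fun x hx y hy ↦ ⟨hS.add_mem hx.1 hy.1, fun ε hε ↦ ?_⟩,
    fun x hx ↦ ⟨hS.neg_mem hx.1, fun ε hε ↦ ?_⟩, fun x hx c hc ↦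
      ⟨⟨hS.mul_mem_left trivial hx.1, fun ε hε ↦ ?_⟩,
        ⟨hS.mul_mem_left trivial hc, fun ε hε ↦ ?_⟩⟩⟩
  · refine ⟨hS.isClosed.closure_subset_iff.2 (fun _ h ↦ h.1) hx, fun ε hε ↦ ?_⟩
    obtain ⟨k, hk, hxk⟩ := Metric.mem_closure_iff.1 hx (ε / 2) (by positivity)
    rw [dist_eq_norm] at hxk
    obtain ⟨g, hg, j, hj, h⟩ := hk.2 (ε / 2) (by positivity)
    refine ⟨g, hg, j, hj, ?_⟩
    have : g * x - j = g * (x - k) + (g * k - j) := by noncomm_ring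
    rw [this]
    have h1 := norm_add_le (g * (x - k)) (g * k - j)
    have h2 := norm_mul_le g (x - k)
    nlinarith [hg.2.2.1, norm_nonneg (x - k)]
  · obtain ⟨g, hg, j, hj, h⟩ := hx.2 (ε / 2) (by positivity)
    obtain ⟨g', hg', j', hj', h'⟩ := hy.2 (ε / 2) (by positivity)
    refine ⟨g * g', mul_mem_centralUnits hS hM hzz hg hg', g' * j + g * j',
      hJ.add_mem (hJ.mul_mem_left trivial hj) (hJ.mul_mem_left trivial hj'), ?_⟩
    have hgg : g * g' = g' * g := ((mem_centerOf_iff hS).1 hg.1).2 g'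
    have : g * g' * (x + y) - (g' * j + g * j') = g' * (g * x - j) + g * (g' * y - j') := by
      rw [mul_add, mul_assoc g g' y, hgg]; noncomm_ring
    rw [this]
    have h1 := norm_add_le (g' * (g * x - j)) (g * (g' * y - j'))
    have h2 := norm_mul_le g' (g * x - j)
    have h3 := norm_mul_le g (g' * y - j')
    nlinarith [hg.2.2.1, hg'.2.2.1, norm_nonneg (g * x - j), norm_nonneg (g' * y - j')]
  · obtain ⟨g, hg, j, hj, h⟩ := hx.2 ε hε
    refine ⟨g, hg, -j, hJ.neg_mem hj, ?_⟩
    have : g * -x - -j = -(g * x - j) := by noncomm_ring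
    rwa [this, norm_neg]
  · obtain ⟨g, hg, j, hj, h⟩ := hx.2 (ε / (‖c‖ + 1)) (by positivity)
    refine ⟨g, hg, c * j, hJ.mul_mem_left trivial hj, ?_⟩
    have : g * (c * x) - c * j = c * (g * x - j) := by
      rw [← mul_assoc, (((mem_centerOf_iff hS).1 hg.1).2 c).eq]; noncomm_ring
    rw [this]
    rw [le_div_iff₀ (by positivity)] at h
    have := norm_mul_le c (g * x - j)
    nlinarith [norm_nonneg (g * x - j)]
  · obtain ⟨g, hg, j, hj, h⟩ := hx.2 (ε / (‖c‖ + 1)) (by positivity)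
    refine ⟨g, hg, j * c, hJ.mul_mem_right hj trivial, ?_⟩
    have : g * (x * c) - j * c = (g * x - j) * c := by noncomm_ring
    rw [this]
    rw [le_div_iff₀ (by positivity)] at h
    have := norm_mul_le (g * x - j) c
    nlinarith [norm_nonneg (g * x - j)]

lemma subset_localIdeal (hJ : IsIdealOf J Set.univ) (hJS : J ⊆ S) {z : A}
    (hz : z ∈ centralUnits S M z) : J ⊆ localIdeal S M J z := fun x hx ↦
  ⟨hJS hx, fun ε hε ↦ ⟨z, hz, z * x, hJ.mul_mem_left trivial hx, by simpa using hε.le⟩⟩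

lemma inter_centerOf_subset_localIdeal (hS : IsIdealOf S Set.univ) (hM : IsIdealOf M Set.univ)
    (hJ : IsIdealOf J Set.univ) {z : A} (hz : z ∈ centralUnits S M z) :
    M ∩ centerOf S ⊆ localIdeal S M J z := by
  rintro c ⟨hcM, hc⟩
  refine ⟨hc.1, fun ε hε ↦ ?_⟩
  obtain ⟨t, ht, h⟩ := exists_cut_approx c hε
  set y := star c * c with hy
  have hsa : IsSelfAdjoint y := .star_mul_self c
  have hyS : y ∈ centerOf S := mul_mem_centerOf hS (star_mem_centerOf hS hc) hc
  have huS := cut_mem_centerOf hS ht hsa hyS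
  have huM : cut t y ∈ M := hM.cut_mem ht hsa (hM.mul_mem_left trivial hcM)
  have hzc := ((mem_centerOf_iff hS).1 hz.1).2
  refine ⟨z - z * cut t y, ⟨sub_mem_centerOf hS hz.1 (mul_mem_centerOf hS hz.1 huS),
    hz.2.1.sub ((hz.2.1.commute_iff (cut_isSelfAdjoint t y)).1 (hzc _)),
    (norm_sub_mul_cut_le_norm ht z hsa).trans hz.2.2.1, ?_⟩, 0, hJ.zero_mem, ?_⟩
  · rw [sub_sub_cancel_left]
    exact hM.neg_mem (hM.mul_mem_left trivial huM)
  · have : (z - z * cut t y) * c - 0 = z * (c - c * cut t y) := by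
      rw [sub_zero, sub_mul, mul_assoc, (((mem_centerOf_iff hS).1 huS).2 c).eq, mul_sub]
    rw [this]
    have := norm_mul_le z (c - c * cut t y)
    nlinarith [hz.2.2.1, norm_nonneg (c - c * cut t y)]

lemma sub_mul_mem_localIdeal (hS : IsIdealOf S Set.univ) (hM : IsIdealOf M Set.univ)
    (hJ : IsIdealOf J Set.univ) {z : A} (hz : z ∈ centralUnits S M z) (hzz : z - z * z ∈ M)
    {s : A} (hs : s ∈ S) : s - s * z ∈ localIdeal S M J z := by
  have hK := isIdealOf_localIdeal hS hM hJ hz hzz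
  have hzc := ((mem_centerOf_iff hS).1 hz.1).2
  refine ⟨hS.sub_mem hs (hS.mul_mem_left trivial hz.1.1), fun ε hε ↦ ?_⟩
  have hmem : (z - z * z) * s ∈ localIdeal S M J z := hK.mul_mem_right
    (inter_centerOf_subset_localIdeal hS hM hJ hz
      ⟨hzz, sub_mem_centerOf hS hz.1 (mul_mem_centerOf hS hz.1 hz.1)⟩) hs
  obtain ⟨g, hg, j, hj, h⟩ := hmem.2 ε hε
  refine ⟨g * z, mul_mem_centralUnits hS hM hzz hg hz, j, hj, ?_⟩
  convert h using 3
  rw [← (hzc s).eq]; noncomm_ring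

lemma notMem_localIdeal (hS : IsIdealOf S Set.univ) (hM : IsIdealOf M S)
    (hJ : IsIdealOf J Set.univ) {z : A} (hz : z ∈ centralUnits S M z) (hzz : z - z * z ∈ M)
    (hzM : z ∉ M) (hJM : centerOf J ⊆ M) : z ∉ localIdeal S M J z := by
  have hMA := hM.trans hS
  rintro ⟨-, hzK⟩
  obtain ⟨g, hg, j, hj, h⟩ := hzK (1 / 8) (by norm_num)
  obtain ⟨hwS, hwsa, -, hwz⟩ := mul_mem_centralUnits hS hMA hzz hg hz
  set w := g * z with hw
  have ht : (0 : ℝ) < 1 / 4 := by norm_num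
  have hu : cut (1 / 4) w ∈ J :=
    hJ.cut_mem_of_norm_sub_lt ht hwsa hj (h.trans_lt (by norm_num))
  have huM : cut (1 / 4) w ∈ M := hJM ((mem_centerOf_iff hJ).2
    ⟨hu, ((mem_centerOf_iff hS).1 (cut_mem_centerOf hS ht hwsa hwS)).2⟩)
  refine hzM (hM.mem_of_idempotent_of_norm_sub_lt_one hz.1.1 hzz
    (l := z - (w - w * cut (1 / 4) w)) ?_ ?_)
  · have : z - (w - w * cut (1 / 4) w) = w * cut (1 / 4) w - (w - z) := by abel
    rw [this]
    exact hM.sub_mem (hMA.mul_mem_left trivial huM) hwz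
  · rw [sub_sub_cancel]
    exact (norm_sub_mul_cut_le ht hwsa).trans_lt (by norm_num)

/-- A closed ideal with a modular unit `z`, idempotent modulo the ideal and not contained in it,
is contained in a modular maximal ideal not containing `z`. -/
lemma exists_isModMaxIdealOf (hS : IsIdealOf S Set.univ) (hK : IsIdealOf K S) {z : A}
    (hz : z ∈ centerOf S) (hunit : ∀ s ∈ S, s - s * z ∈ K) (hzK : z ∉ K) :
    ∃ N, IsModMaxIdealOf N S ∧ K ⊆ N ∧ z ∉ N := by
  obtain ⟨N, hKN, ⟨hNS, -, hzN⟩, hmax⟩ := zorn_subset_nonempty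
    {L : Set A | IsIdealOf L S ∧ K ⊆ L ∧ z ∉ L} (fun c hc hchain hne ↦ by
      have hU : ∀ x ∈ ⋃₀ c, ∀ y ∈ ⋃₀ c, ∃ L ∈ c, x ∈ L ∧ y ∈ L := by
        rintro x ⟨L₁, h₁, hx⟩ y ⟨L₂, h₂, hy⟩
        rcases hchain.total h₁ h₂ with h | h
        · exact ⟨L₂, h₂, h hx, hy⟩
        · exact ⟨L₁, h₁, hx, h hy⟩
      obtain ⟨L₀, hL₀⟩ := hne
      refine ⟨closure (⋃₀ c), ⟨⟨?_, isClosed_closure, ?_, ?_, ?_, ?_⟩, ?_, ?_⟩,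
        fun L hL ↦ (Set.subset_sUnion_of_mem hL).trans subset_closure⟩
      · exact hS.isClosed.closure_subset_iff.2 (Set.sUnion_subset fun L hL ↦ (hc hL).1.subset)
      · exact subset_closure ⟨L₀, hL₀, (hc hL₀).1.zero_mem⟩
      · exact fun x hx y hy ↦ map_mem_closure₂ continuous_add hx hy fun a ha b hb ↦ by
          obtain ⟨L, hL, haL, hbL⟩ := hU a ha b hb
          exact ⟨L, hL, (hc hL).1.add_mem haL hbL⟩
      · exact fun x hx ↦ map_mem_closure continuous_neg hx fun a ⟨L, hL, haL⟩ ↦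
          ⟨L, hL, (hc hL).1.neg_mem haL⟩
      · exact fun x hx a ha ↦
          ⟨map_mem_closure (continuous_const_mul a) hx fun b ⟨L, hL, hbL⟩ ↦
            ⟨L, hL, (hc hL).1.mul_mem_left ha hbL⟩,
          map_mem_closure (f := (· * a)) (continuous_mul_const a) hx fun b ⟨L, hL, hbL⟩ ↦
            ⟨L, hL, (hc hL).1.mul_mem_right hbL ha⟩⟩
      · exact (hc hL₀).2.1.trans ((Set.subset_sUnion_of_mem hL₀).trans subset_closure)
      · intro hzc
        obtain ⟨l, ⟨L, hL, hl⟩, hlt⟩ := Metric.mem_closure_iff.1 hzc 1 one_pos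
        rw [dist_eq_norm] at hlt
        exact (hc hL).2.2 ((hc hL).1.mem_of_idempotent_of_norm_sub_lt_one hz.1
          ((hc hL).2.1 (hunit z hz.1)) hl hlt)) K ⟨hK, subset_rfl, hzK⟩
  refine ⟨N, ⟨hNS, fun h ↦ hzN (h ▸ hz.1), fun I hI hNI ↦ ?_, z, hz.1, fun s hs ↦
    ⟨hKN (hunit s hs), ?_⟩⟩, hKN, hzN⟩
  · by_cases hzI : z ∈ I
    · exact .inr (Set.Subset.antisymm hI.subset fun s hs ↦
        hI.mem_of_sub_mem (hNI (hKN (hunit s hs))) (hI.mul_mem_left hs hzI))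
    · exact .inl (Set.Subset.antisymm (hmax ⟨hI, hKN.trans hNI, hzI⟩ hNI) hNI)
  · rw [hz.2 s hs]
    exact hKN (hunit s hs)

/-- If the centre of `J` is contained in the modular maximal ideal `M` of `S`, while the centre
of `S` is not, then some modular maximal ideal of `S` containing `J` has the same intersection
with the centre of `S` as `M`. -/
lemma exists_isModMaxIdealOf_inter_eq (hS : IsIdealOf S Set.univ) (hJ : IsIdealOf J Set.univ)
    (hJS : J ⊆ S) (hM : IsModMaxIdealOf M S) (hSM : ¬ centerOf S ⊆ M) (hJM : centerOf J ⊆ M) :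
    ∃ N, IsModMaxIdealOf N S ∧ J ⊆ N ∧ N ∩ centerOf S = M ∩ centerOf S := by
  have hMA := hM.1.trans hS
  obtain ⟨n, hn, hnM⟩ := Set.not_subset.1 hSM
  obtain ⟨t, ht, htM, hunit⟩ := hM.exists_cut hS hn hnM
  set z := cut (t / 2) (star n * n) with hzdef
  have hsa : IsSelfAdjoint (star n * n) := .star_mul_self n
  have hyS := mul_mem_centerOf hS (star_mem_centerOf hS hn) hn
  have hzS : z ∈ centerOf S := cut_mem_centerOf hS (half_pos ht) hsa hyS
  have hzz : z - z * z ∈ M := hunit z hzS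
  have hzM : z ∉ M := fun h ↦ htM (hMA.mem_of_sub_mem
    (hunit _ (cut_mem_centerOf hS ht hsa hyS)) (hMA.mul_mem_left trivial h))
  have hz : z ∈ centralUnits S M z := ⟨hzS, cut_isSelfAdjoint _ _,
    norm_cut_le (half_pos ht) _, by simpa using hMA.zero_mem⟩
  obtain ⟨N, hN, hKN, hzN⟩ := exists_isModMaxIdealOf hS (isIdealOf_localIdeal hS hMA hJ hz hzz)
    hzS (fun s hs ↦ sub_mul_mem_localIdeal hS hMA hJ hz hzz hs)
    (notMem_localIdeal hS hM.1 hJ hz hzz hzM hJM)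
  have hMN : M ∩ centerOf S ⊆ N := (inter_centerOf_subset_localIdeal hS hMA hJ hz).trans hKN
  refine ⟨N, hN, (subset_localIdeal hJ hJS hz).trans hKN,
    Set.Subset.antisymm (fun a ha ↦ ⟨?_, ha.2⟩) fun a ha ↦ ⟨hMN ha, ha.2⟩⟩
  by_contra haM
  obtain ⟨r, hr, -, hr'⟩ := hM.exists_cut hS ha.2 haM
  have hNA := hN.1.trans hS
  have hsa' : IsSelfAdjoint (star a * a) := .star_mul_self a
  have hcut := cut_mem_centerOf hS (half_pos hr) hsa'
    (mul_mem_centerOf hS (star_mem_centerOf hS ha.2) ha.2)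
  have hcutN := hNA.cut_mem (half_pos hr) hsa' (hNA.mul_mem_left trivial ha.1)
  exact hzN (hNA.mem_of_sub_mem (hMN ⟨hr' z hzS,
    sub_mem_centerOf hS hzS (mul_mem_centerOf hS hzS hcut)⟩) (hNA.mul_mem_left trivial hcutN))

/-- The centre of a closed ideal of a weakly central ideal is not contained in any modular maximal
ideal which does not contain the ideal. -/
lemma WeaklyCentral.not_centerOf_subset (hS : IsIdealOf S Set.univ) (hw : WeaklyCentral S)
    (hJ : IsIdealOf J Set.univ) (hJS : J ⊆ S) (hM : IsModMaxIdealOf M S) (hJM : ¬ J ⊆ M) :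
    ¬ centerOf J ⊆ M := fun h ↦ by
  obtain ⟨N, hN, hJN, heq⟩ :=
    exists_isModMaxIdealOf_inter_eq hS hJ hJS hM (hw.1 M hM) h
  exact hJM (hw.2 N M hN hM heq ▸ hJN)

/-- Closed ideals of weakly central ideals are weakly central. -/
lemma WeaklyCentral.of_subset (hS : IsIdealOf S Set.univ) (hw : WeaklyCentral S)
    (hJ : IsIdealOf J Set.univ) (hJS : J ⊆ S) : WeaklyCentral J := by
  have hnot : ∀ M N, IsModMaxIdealOf M J → IsModMaxIdealOf N S → N ∩ J = M →
      ¬ centerOf J ⊆ N := fun M N hM hN hNM ↦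
    hw.not_centerOf_subset hS hJ hJS hN fun h ↦
      hM.2.1 (hNM ▸ Set.inter_eq_right.2 h)
  refine ⟨fun M hM h ↦ ?_, fun M₁ M₂ hM₁ hM₂ heq ↦ ?_⟩
  · obtain ⟨N, hN, hNM⟩ := hM.exists_extension hS hJ hJS
    refine hnot M N hM hN hNM (h.trans ?_)
    rw [← hNM]
    exact Set.inter_subset_left
  · have key : ∀ M₁ M₂ N₁ N₂ : Set A, IsModMaxIdealOf N₁ S →
        N₁ ∩ J = M₁ → IsModMaxIdealOf N₂ S → N₂ ∩ J = M₂ → IsModMaxIdealOf M₂ J →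
        M₁ ∩ centerOf J = M₂ ∩ centerOf J → N₁ ∩ centerOf S ⊆ N₂ ∩ centerOf S := by
      intro M₁ M₂ N₁ N₂ hN₁ h₁ hN₂ h₂ hM₂ heq z hz
      obtain ⟨w, hw, hwN⟩ := Set.not_subset.1 (hnot M₂ N₂ hM₂ hN₂ h₂)
      have hwS := centerOf_subset_centerOf hJ hS hJS hw
      refine ⟨hN₂.mem_of_mul_mem hS hz.2.1 hwS ?_ hwN, hz.2⟩
      have hzwJ : z * w ∈ J := hJ.mul_mem_left trivial hw.1
      have hzw : z * w ∈ M₁ ∩ centerOf J := by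
        refine ⟨h₁ ▸ ⟨hN₁.1.mul_mem_right hz.1 hwS.1, hzwJ⟩, (mem_centerOf_iff hJ).2 ⟨hzwJ, ?_⟩⟩
        exact ((mem_centerOf_iff hS).1 (mul_mem_centerOf hS hz.2 hwS)).2
      rw [heq, ← h₂] at hzw
      exact hzw.1.1
    obtain ⟨N₁, hN₁, h₁⟩ := hM₁.exists_extension hS hJ hJS
    obtain ⟨N₂, hN₂, h₂⟩ := hM₂.exists_extension hS hJ hJS
    have := hw.2 N₁ N₂ hN₁ hN₂ (Set.Subset.antisymm
      (key M₁ M₂ N₁ N₂ hN₁ h₁ hN₂ h₂ hM₂ heq)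
      (key M₂ M₁ N₂ N₁ hN₂ h₂ hN₁ h₁ hM₁ heq.symm))
    rw [← h₁, ← h₂, this]

/-- If `K` is weakly central and not contained in the modular maximal ideal `M`, then neither is
the centre of `K`. -/
lemma WeaklyCentral.not_centerOf_subset_of_not_subset (hS : IsIdealOf S Set.univ)
    (hK : IsIdealOf K Set.univ) (hw : WeaklyCentral K) (hKS : K ⊆ S) (hM : IsModMaxIdealOf M S)
    (hKM : ¬ K ⊆ M) : ¬ centerOf K ⊆ M := fun h ↦
  hw.1 _ (hM.inter hS hK hKS hKM) fun _ hz ↦ ⟨h hz, hz.1⟩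

/-- Modular maximal ideals which agree on the centre agree as soon as one of them does not
contain some weakly central closed ideal. -/
lemma WeaklyCentral.eq_of_inter_centerOf_eq {N : Set A} (hS : IsIdealOf S Set.univ)
    (hK : IsIdealOf K Set.univ) (hw : WeaklyCentral K) (hKS : K ⊆ S) (hM : IsModMaxIdealOf M S)
    (hN : IsModMaxIdealOf N S) (hKM : ¬ K ⊆ M) (heq : M ∩ centerOf S = N ∩ centerOf S) :
    M = N := by
  have hcen := centerOf_subset_centerOf hK hS hKS
  have hiff : ∀ z ∈ centerOf K, z ∈ M ↔ z ∈ N := fun z hz ↦ by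
    simpa [hcen hz] using Set.ext_iff.1 heq z
  have hKN : ¬ K ⊆ N := fun h ↦
    hw.not_centerOf_subset_of_not_subset hS hK hKS hM hKM fun z hz ↦ (hiff z hz).2 (h hz.1)
  refine hM.eq_of_inter_eq hS hN hK hKS hKM
    (hw.2 _ _ (hM.inter hS hK hKS hKM) (hN.inter hS hK hKS hKN) (Set.ext fun z ↦ ?_))
  simp only [Set.mem_inter_iff]
  constructor
  · exact fun ⟨⟨h, hk⟩, hz⟩ ↦ ⟨⟨(hiff z hz).1 h, hk⟩, hz⟩
  · exact fun ⟨⟨h, hk⟩, hz⟩ ↦ ⟨⟨(hiff z hz).2 h, hk⟩, hz⟩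

/-- The sum of two weakly central closed ideals is weakly central. -/
lemma WeaklyCentral.add {K₁ K₂ : Set A} (h₁ : IsIdealOf K₁ Set.univ) (hw₁ : WeaklyCentral K₁)
    (h₂ : IsIdealOf K₂ Set.univ) (hw₂ : WeaklyCentral K₂) : WeaklyCentral (K₁ + K₂) := by
  have hS := h₁.add h₂
  have hs₁ : K₁ ⊆ K₁ + K₂ := fun x hx ↦ ⟨x, hx, 0, h₂.zero_mem, add_zero x⟩
  have hs₂ : K₂ ⊆ K₁ + K₂ := fun x hx ↦ ⟨0, h₁.zero_mem, x, hx, zero_add x⟩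
  have hor : ∀ M, IsModMaxIdealOf M (K₁ + K₂) → ¬ K₁ ⊆ M ∨ ¬ K₂ ⊆ M := by
    intro M hM
    by_contra! h
    refine hM.2.1 (Set.Subset.antisymm hM.1.subset ?_)
    rintro _ ⟨a, ha, b, hb, rfl⟩
    exact hM.1.add_mem (h.1 ha) (h.2 hb)
  refine ⟨fun M hM h ↦ ?_, fun M N hM hN heq ↦ ?_⟩
  · rcases hor M hM with hK | hK
    · exact hw₁.not_centerOf_subset_of_not_subset hS h₁ hs₁ hM hK
        ((centerOf_subset_centerOf h₁ hS hs₁).trans h)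
    · exact hw₂.not_centerOf_subset_of_not_subset hS h₂ hs₂ hM hK
        ((centerOf_subset_centerOf h₂ hS hs₂).trans h)
  · rcases hor M hM with hK | hK
    · exact hw₁.eq_of_inter_centerOf_eq hS h₁ hs₁ hM hN hK heq
    · exact hw₂.eq_of_inter_centerOf_eq hS h₂ hs₂ hM hN hK heq

end Main

end CQP

/-- **Corollary 3.20.** Let `A` be a C*-algebra.
(a) For any ideal `I` of `A`, `J_wc(I) = I ∩ J_wc(A)`.
(b) The sum of any two weakly central ideals of `A` is a weakly central ideal of `A`. -/
theorem stmt9 {A : Type*} [NonUnitalCStarAlgebra A] :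
    (∀ I Jwc JI : Set A, IsIdealOf I (Set.univ : Set A) →
      IsLargestWCIdealOf Jwc (Set.univ : Set A) → IsLargestWCIdealOf JI I →
        JI = I ∩ Jwc) ∧
    (∀ K₁ K₂ : Set A,
      IsIdealOf K₁ (Set.univ : Set A) → WeaklyCentral K₁ →
      IsIdealOf K₂ (Set.univ : Set A) → WeaklyCentral K₂ →
        IsIdealOf (K₁ + K₂) (Set.univ : Set A) ∧ WeaklyCentral (K₁ + K₂)) := by
  refine ⟨fun I Jwc JI hI hJ hJI ↦ ?_, fun K₁ K₂ h₁ hw₁ h₂ hw₂ ↦ ⟨h₁.add h₂, hw₁.add h₁ h₂ hw₂⟩⟩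
  refine Set.Subset.antisymm (Set.subset_inter hJI.1.subset
    (hJ.2.2 JI (hJI.1.trans hI) hJI.2.1)) (hJI.2.2 _ ?_ ?_)
  · exact (hI.inter hJ.1).of_subset Set.inter_subset_left (Set.subset_univ _)
  · exact hJ.2.1.of_subset hJ.1 (hI.inter hJ.1) Set.inter_subset_right
end

section
/- Let A be a C*-algebra and let J and K be ideals of A. If at least one of J or K has the centre-quotient (CQ) property, then Z(J+K) = Z(J) + Z(K). -/
open Filter Topology Pointwise

open CQP

/-- A central element of a two-sided ideal of a C*-algebra is central in the whole algebra. -/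
theorem commute_of_mem_centerOf {A : Type*} [NonUnitalCStarAlgebra A] {J : Set A}
    (hJ : IsIdealOf J (Set.univ : Set A)) {z : A} (hz : z ∈ centerOf J) (a : A) :
    z * a = a * z := by
  obtain ⟨-, -, -, hadd, hneg, hmul⟩ := hJ
  obtain ⟨hzJ, hcomm⟩ := hz
  set d := z * a - a * z with hd
  have hdJ : d ∈ J := by
    rw [hd, sub_eq_add_neg]
    exact hadd _ (hmul z hzJ a trivial).2 _ (hneg _ (hmul z hzJ a trivial).1)
  have hann : ∀ x ∈ J, x * d = 0 := fun x hx => by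
    rw [hd, mul_sub, ← mul_assoc, ← mul_assoc, ← hcomm x hx, mul_assoc,
      hcomm (x * a) (hmul x hx a trivial).2, sub_self]
  have hddd : d * star d * d = 0 := hann _ (hmul d hdJ (star d) trivial).2
  have hsq : star (star d * d) * (star d * d) = 0 := by
    rw [star_mul, star_star, mul_assoc, ← mul_assoc d, hddd, mul_zero]
  have hd0 : d = 0 :=
    CStarRing.star_mul_self_eq_zero_iff d |>.1 (CStarRing.star_mul_self_eq_zero_iff _ |>.1 hsq)
  exact sub_eq_zero.1 hd0

/-- If `J` has the centre-quotient property, then every central element of `J + K` is a sum of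
central elements of `J` and `K`. -/
theorem centerOf_add_subset_of_hasCQ {A : Type*} [NonUnitalCStarAlgebra A] {J K : Set A}
    (hJ : IsIdealOf J (Set.univ : Set A)) (hK : IsIdealOf K (Set.univ : Set A))
    (h : HasCQ J) : centerOf (J + K) ⊆ centerOf J + centerOf K := by
  have hcent := fun w (hw : w ∈ centerOf J) => commute_of_mem_centerOf hJ hw
  obtain ⟨-, hJc, hJ0, hJadd, hJneg, hJmul⟩ := hJ
  obtain ⟨-, hKc, hK0, hKadd, hKneg, hKmul⟩ := hK
  rintro z ⟨⟨j, hj, k, hk, rfl⟩, hz⟩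
  have hI : IsIdealOf (J ∩ K) J :=
    ⟨Set.inter_subset_left, hJc.inter hKc, ⟨hJ0, hK0⟩,
      fun x hx y hy => ⟨hJadd x hx.1 y hy.1, hKadd x hx.2 y hy.2⟩,
      fun x hx => ⟨hJneg x hx.1, hKneg x hx.2⟩,
      fun x hx a _ => ⟨⟨(hJmul x hx.1 a trivial).1, (hKmul x hx.2 a trivial).1⟩,
        ⟨(hJmul x hx.1 a trivial).2, (hKmul x hx.2 a trivial).2⟩⟩⟩
  have hjI : ∀ x ∈ J, j * x - x * j ∈ J ∩ K := fun x hx => by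
    have hzx : (j + k) * x = x * (j + k) := hz x ⟨x, hx, 0, hK0, add_zero x⟩
    have hswap : j * x - x * j = x * k + -(k * x) := by
      rw [add_mul, mul_add] at hzx
      rw [← sub_eq_add_neg, sub_eq_sub_iff_add_eq_add, hzx, add_comm]
    refine ⟨?_, ?_⟩
    · rw [sub_eq_add_neg]
      exact hJadd _ (hJmul x hx j trivial).1 _ (hJneg _ (hJmul x hx j trivial).2)
    · rw [hswap]
      exact hKadd _ (hKmul k hk x trivial).1 _ (hKneg _ (hKmul k hk x trivial).2)
  obtain ⟨w, hw, hjw⟩ := h (J ∩ K) hI j hj hjI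
  refine ⟨w, hw, (j - w) + k, ⟨hKadd _ hjw.2 _ hk, fun y hy => ?_⟩, by simp only; abel⟩
  have hzy : (j + k) * y = y * (j + k) := hz y ⟨0, hJ0, y, hy, zero_add y⟩
  have hsplit : j - w + k = j + k - w := by abel
  rw [hsplit, sub_mul, mul_sub, hzy, hcent w hw y]

/-- **Proposition 3.23.** Let `J` and `K` be ideals of a C*-algebra `A`. If at least one
of `J` or `K` has the CQ-property, then `Z(J+K) = Z(J) + Z(K)`. -/
theorem stmt10 {A : Type*} [NonUnitalCStarAlgebra A] (J K : Set A)
    (hJ : IsIdealOf J (Set.univ : Set A)) (hK : IsIdealOf K (Set.univ : Set A))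
    (h : HasCQ J ∨ HasCQ K) :
    centerOf (J + K) = centerOf J + centerOf K := by
  apply Set.Subset.antisymm
  · rcases h with h | h
    · exact centerOf_add_subset_of_hasCQ hJ hK h
    · rw [add_comm J K, add_comm (centerOf J)]
      exact centerOf_add_subset_of_hasCQ hK hJ h
  · rintro _ ⟨u, hu, v, hv, rfl⟩
    refine ⟨⟨u, hu.1, v, hv.1, rfl⟩, fun x _ => ?_⟩
    change (u + v) * x = x * (u + v)
    rw [add_mul, mul_add, commute_of_mem_centerOf hJ hu x, commute_of_mem_centerOf hK hv x]
end

section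
/- Let A be a C*-algebra. Every commutator [a,b] = ab − ba (a, b ∈ A) belongs to CQ(A). In particular, CQ(A) = Z(A) if and only if A is abelian (commutative). -/
open Filter Topology Pointwise

open CQP

theorem iterate_commutator_pow {Q : Type*} [Ring Q] {a b c : Q} (hc : a * b - b * a = c)
    (hac : Commute a c) (hbc : Commute b c) (n : ℕ) :
    (fun x => a * x - x * a)^[n] (b ^ n) = (n.factorial : Q) * c ^ n := by
  have pow_rule (n : ℕ) : a * b ^ (n + 1) - b ^ (n + 1) * a = ((n + 1 : ℕ) : Q) * c * b ^ n := by
    induction n with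
    | zero => simp [hc]
    | succ n ih =>
      have hbn : b ^ (n + 1) * c = c * b ^ (n + 1) := (hbc.pow_left (n + 1)).eq
      calc a * b ^ (n + 1 + 1) - b ^ (n + 1 + 1) * a
          = (a * b ^ (n + 1) - b ^ (n + 1) * a) * b + b ^ (n + 1) * (a * b - b * a) := by
            rw [pow_succ b (n + 1)]; noncomm_ring
        _ = ((n + 1 + 1 : ℕ) : Q) * c * b ^ (n + 1) := by
            rw [ih, hc, hbn, mul_assoc _ (b ^ n) b, ← pow_succ]; push_cast; noncomm_ring
  have semi (m : ℕ) : Function.Semiconj (fun x => (m : Q) * c * x)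
      (fun x => a * x - x * a) (fun x => a * x - x * a) := fun x => by
    have h : a * ((m : Q) * c) = (m : Q) * c * a :=
      ((Nat.cast_commute m a).symm.mul_right hac).eq
    simp only [mul_sub, ← mul_assoc, h]
  induction n with
  | zero => simp
  | succ n ih =>
    rw [Function.iterate_succ_apply, pow_rule n,
      ← ((semi (n + 1)).iterate_right n).eq (b ^ n), ih, Nat.factorial_succ]
    have h : c * (n.factorial : Q) = n.factorial * c := (Nat.cast_commute _ c).symm.eq
    calc ((n + 1 : ℕ) : Q) * c * ((n.factorial : Q) * c ^ n)
        = ((n + 1 : ℕ) : Q) * (c * (n.factorial : Q)) * c ^ n := by simp only [mul_assoc]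
      _ = _ := by rw [h, pow_succ' c n]; push_cast; simp only [mul_assoc]

theorem norm_iterate_commutator_le {U : Type*} [NormedRing U] (a x : U) (n : ℕ) :
    ‖(fun x => a * x - x * a)^[n] x‖ ≤ (2 * ‖a‖) ^ n * ‖x‖ := by
  induction n with
  | zero => simp
  | succ n ih =>
    rw [Function.iterate_succ_apply']
    set y := (fun x => a * x - x * a)^[n] x
    calc ‖a * y - y * a‖ ≤ ‖a * y‖ + ‖y * a‖ := norm_sub_le _ _
      _ ≤ ‖a‖ * ‖y‖ + ‖y‖ * ‖a‖ := add_le_add (norm_mul_le _ _) (norm_mul_le _ _)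
      _ = 2 * ‖a‖ * ‖y‖ := by ring
      _ ≤ 2 * ‖a‖ * ((2 * ‖a‖) ^ n * ‖x‖) := by gcongr
      _ = _ := by ring

theorem exists_norm_sub_mul_le_and_pow_factor {U : Type*} [CStarAlgebra U] (c : U) {δ : ℝ}
    (hδ : 0 < δ) :
    ∃ k : U, ‖c - c * k‖ ^ 2 ≤ δ ∧
      ∀ n : ℕ, ∃ g : U, ‖g‖ ≤ (δ ^ n)⁻¹ ∧ (star c * c) ^ n * g = k := by
  set h := star c * c with hh
  have hsa : IsSelfAdjoint h := IsSelfAdjoint.star_mul_self c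
  have hpos : ∀ t ∈ spectrum ℝ h, 0 ≤ t := spectrum_star_mul_self_nonneg
  have hmax (t : ℝ) : 0 < max t δ := lt_max_of_lt_right hδ
  have hcont : Continuous fun t : ℝ => δ / max t δ :=
    continuous_const.div (continuous_id.max continuous_const) fun t => (hmax t).ne'
  have hle (t : ℝ) : δ / max t δ ≤ 1 := (div_le_one (hmax t)).2 (le_max_right _ _)
  have hnonneg (t : ℝ) : 0 ≤ δ / max t δ := (div_pos hδ (hmax t)).le
  set m := cfc (fun t : ℝ => δ / max t δ) h with hm
  have hmsa : star m = m := cfc_predicate (p := IsSelfAdjoint) (fun t : ℝ => δ / max t δ) h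
  refine ⟨1 - m, ?_, fun n => ?_⟩
  · have e1 : c - c * (1 - m) = c * m := by noncomm_ring
    have e2 : star (c * m) * (c * m) = cfc (fun t : ℝ => δ / max t δ * t * (δ / max t δ)) h := by
      rw [cfc_mul (fun t : ℝ => δ / max t δ * t) (fun t => δ / max t δ) h
          (hcont.mul continuous_id).continuousOn hcont.continuousOn,
        cfc_mul (fun t : ℝ => δ / max t δ) (fun t => t) h hcont.continuousOn
          continuous_id.continuousOn, cfc_id' ℝ h, ← hm, star_mul, hmsa, hh]
      simp only [mul_assoc]
    rw [e1, sq, ← CStarRing.norm_star_mul_self, e2]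
    refine norm_cfc_le hδ.le fun t ht => ?_
    have ht0 := hpos t ht
    have h1 : δ / max t δ * t ≤ δ := by
      rw [div_mul_eq_mul_div, div_le_iff₀ (hmax t)]
      gcongr
      exact le_max_left _ _
    rw [Real.norm_of_nonneg (by have := hnonneg t; positivity)]
    calc δ / max t δ * t * (δ / max t δ) ≤ δ * 1 :=
          mul_le_mul h1 (hle t) (hnonneg t) hδ.le
      _ = δ := mul_one δ
  · have hgcont : Continuous fun t : ℝ => (1 - δ / max t δ) / max t δ ^ n :=
      (continuous_const.sub hcont).div ((continuous_id.max continuous_const).pow n)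
        fun t => (pow_pos (hmax t) n).ne'
    refine ⟨cfc (fun t : ℝ => (1 - δ / max t δ) / max t δ ^ n) h, ?_, ?_⟩
    · refine norm_cfc_le (by positivity) fun t _ => ?_
      have h1 : 0 ≤ 1 - δ / max t δ := sub_nonneg.2 (hle t)
      have h2 := pow_pos (hmax t) n
      rw [Real.norm_of_nonneg (by positivity), ← one_div]
      have h3 : 1 - δ / max t δ ≤ 1 := by linarith [hnonneg t]
      gcongr
      exact le_max_right _ _
    · rw [← cfc_pow_id (R := ℝ) h n, ← cfc_mul (fun t : ℝ => t ^ n) _ h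
        (continuous_pow n).continuousOn hgcont.continuousOn, hm,
        ← cfc_const_one ℝ h, ← cfc_sub _ _ h continuous_const.continuousOn hcont.continuousOn]
      refine cfc_congr fun t ht => ?_
      have h2 := pow_pos (hmax t) n
      rcases le_total t δ with htδ | htδ
      · simp [max_eq_right htδ, hδ.ne']
      · have htp : t ≠ 0 := (hδ.trans_le htδ).ne'
        simp only [max_eq_left htδ]
        field_simp

/-- A Kleinecke–Shirokov theorem modulo a closed ideal: a commutator that is central modulo a
closed two-sided ideal of a C⋆-algebra belongs to this ideal. -/
theorem commutator_mem_of_central_mod {U : Type*} [CStarAlgebra U] (J : TwoSidedIdeal U)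
    (hJ : IsClosed (J : Set U)) (a b : U)
    (hcen : ∀ x : U, (a * b - b * a) * x - x * (a * b - b * a) ∈ J) : a * b - b * a ∈ J := by
  set c := a * b - b * a with hc
  let q := J.ringCon.mk'
  have hq (x y : U) : q x = q y ↔ x - y ∈ J := by
    rw [← TwoSidedIdeal.rel_iff]; exact RingCon.eq _
  have hcomm (x : U) : Commute (q x) (q c) := by
    have := (hq (c * x) (x * c)).2 (hcen x)
    simpa only [map_mul] using! this.symm
  have hD (n : ℕ) : q ((fun x => a * x - x * a)^[n] (b ^ n)) =
      (n.factorial : J.ringCon.Quotient) * q c ^ n := by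
    have semi : Function.Semiconj q (fun x => a * x - x * a)
        (fun x => q a * x - x * q a) := fun x => by simp only [map_sub, map_mul]
    rw [(semi.iterate_right n).eq, map_pow]
    exact iterate_commutator_pow (by rw [hc, map_sub, map_mul, map_mul]) (hcomm a) (hcomm b) n
  have key {δ : ℝ} (hδ : 0 < δ) : ∃ k ∈ J, ‖c - c * k‖ ^ 2 ≤ δ := by
    obtain ⟨k, hk, hg⟩ := exists_norm_sub_mul_le_and_pow_factor c hδ
    refine ⟨k, ?_, hk⟩
    choose g hgn hgk using hg
    let y (n : ℕ) : U := star c ^ n * (fun x => a * x - x * a)^[n] (b ^ n)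
    have hmem (n : ℕ) : k - (n.factorial : ℂ)⁻¹ • (y n * g n) ∈ J := by
      have h1 : (n.factorial : U) * (star c * c) ^ n - y n ∈ J := by
        rw [← hq]
        simp only [y, map_mul, map_pow, hD, map_natCast]
        rw [(hcomm (star c)).mul_pow, ← mul_assoc, ← mul_assoc,
          (Nat.cast_commute n.factorial (q (star c) ^ n)).eq]
      have h2 := J.mul_mem_left (algebraMap ℂ U (n.factorial : ℂ)⁻¹) _
        (J.mul_mem_right _ (g n) h1)
      have hf : (n.factorial : ℂ) ≠ 0 := Nat.cast_ne_zero.2 n.factorial_ne_zero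
      have hf' : (n.factorial : U) = algebraMap ℂ U (n.factorial : ℂ) := by simp
      convert h2 using 1
      rw [sub_mul, mul_assoc (n.factorial : U) _ (g n), hgk n, mul_sub, hf', ← mul_assoc, ← map_mul,
        inv_mul_cancel₀ hf, map_one, one_mul, Algebra.smul_def]
    have hlim : Tendsto (fun n : ℕ => k - (n.factorial : ℂ)⁻¹ • (y n * g n)) atTop (𝓝 k) := by
      have h0 : Tendsto (fun n : ℕ => (n.factorial : ℂ)⁻¹ • (y n * g n)) atTop (𝓝 0) := by
        refine squeeze_zero_norm' ?_ (FloorSemiring.tendsto_pow_div_factorial_atTop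
          (‖c‖ * (2 * ‖a‖) * ‖b‖ * δ⁻¹))
        filter_upwards [eventually_gt_atTop 0] with n hn
        have h1 : ‖y n‖ ≤ ‖c‖ ^ n * ((2 * ‖a‖) ^ n * ‖b‖ ^ n) := by
          refine (norm_mul_le _ _).trans ?_
          gcongr
          · exact (norm_pow_le' _ hn).trans_eq (by rw [norm_star])
          · refine (norm_iterate_commutator_le _ _ _).trans ?_
            gcongr
            exact norm_pow_le' _ hn
        calc ‖(n.factorial : ℂ)⁻¹ • (y n * g n)‖
            ≤ (n.factorial : ℝ)⁻¹ * (‖y n‖ * ‖g n‖) := by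
              rw [norm_smul, norm_inv, Complex.norm_natCast]
              gcongr
              exact norm_mul_le _ _
          _ ≤ (n.factorial : ℝ)⁻¹ * ((‖c‖ ^ n * ((2 * ‖a‖) ^ n * ‖b‖ ^ n)) * (δ ^ n)⁻¹) := by
              gcongr
              exact hgn n
          _ = _ := by simp only [mul_pow, inv_pow]; ring
      simpa using tendsto_const_nhds.sub h0
    exact hJ.mem_of_tendsto hlim (Eventually.of_forall hmem)
  rw [← SetLike.mem_coe, ← hJ.closure_eq, Metric.mem_closure_iff]
  intro ε hε
  obtain ⟨k, hkJ, hk⟩ := key (δ := (ε / 2) ^ 2) (by positivity)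
  refine ⟨c * k, J.mul_mem_left _ _ hkJ, ?_⟩
  rw [dist_eq_norm]
  have := (sq_le_sq₀ (norm_nonneg _) (by positivity)).1 hk
  linarith

theorem smul_mem_of_isIdealOf_univ {A : Type*} [NonUnitalCStarAlgebra A] {I : Set A}
    (hI : IsIdealOf I Set.univ) (r : ℂ) {x : A} (hx : x ∈ I) : r • x ∈ I := by
  let _ := CStarAlgebra.spectralOrder A
  let _ := CStarAlgebra.spectralOrderedRing A
  have hu := (CStarAlgebra.increasingApproximateUnit A).toIsApproximateUnit
  have := hu.neBot
  refine hI.2.1.mem_of_tendsto (hu.tendsto_mul_right (r • x)) (Eventually.of_forall fun e => ?_)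
  have : e * r • x = (r • e) * x := by rw [mul_smul_comm, smul_mul_assoc]
  exact this ▸ (hI.2.2.2.2.2 x hx (r • e) trivial).1

theorem commutator_mem_of_isIdealOf_univ {A : Type*} [NonUnitalCStarAlgebra A] {I : Set A}
    (hI : IsIdealOf I Set.univ) (a b : A)
    (hcen : ∀ x : A, (a * b - b * a) * x - x * (a * b - b * a) ∈ I) : a * b - b * a ∈ I := by
  have hsmul (r : ℂ) (x : A) (hx : x ∈ I) := smul_mem_of_isIdealOf_univ hI r hx
  obtain ⟨-, hcl, h0, hadd, hneg, hmul⟩ := hI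
  let J : TwoSidedIdeal (Unitization ℂ A) := TwoSidedIdeal.mk'
    ((Unitization.inr : A → Unitization ℂ A) '' I)
    ⟨0, h0, Unitization.inr_zero ℂ⟩
    (by
      rintro _ _ ⟨x, hx, rfl⟩ ⟨y, hy, rfl⟩
      exact ⟨x + y, hadd x hx y hy, Unitization.inr_add ℂ x y⟩)
    (by
      rintro _ ⟨x, hx, rfl⟩
      exact ⟨-x, hneg x hx, Unitization.inr_neg ℂ x⟩)
    (by
      rintro u _ ⟨y, hy, rfl⟩
      refine ⟨u.fst • y + u.snd * y, hadd _ (hsmul _ y hy) _ (hmul y hy _ trivial).1, ?_⟩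
      ext <;> simp)
    (by
      rintro _ u ⟨y, hy, rfl⟩
      refine ⟨u.fst • y + y * u.snd, hadd _ (hsmul _ y hy) _ (hmul y hy _ trivial).2, ?_⟩
      ext <;> simp)
  have hJ : (J : Set (Unitization ℂ A)) = Unitization.inr '' I := TwoSidedIdeal.coe_mk' ..
  have hJcl : IsClosed (J : Set (Unitization ℂ A)) := by
    rw [hJ]
    exact (Unitization.isometry_inr (𝕜 := ℂ) (A := A)).isClosedEmbedding.isClosedMap _ hcl
  have hmem (u : Unitization ℂ A) : u ∈ J ↔ u ∈ (Unitization.inr : A → Unitization ℂ A) '' I := by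
    rw [← hJ]; rfl
  have hcomm : (a : Unitization ℂ A) * b - b * a = ((a * b - b * a : A) : Unitization ℂ A) := by
    simp
  have := commutator_mem_of_central_mod J hJcl (a : Unitization ℂ A) (b : Unitization ℂ A)
    (fun u => by
      rw [hmem, hcomm]
      refine ⟨_, hcen u.snd, ?_⟩
      generalize a * b - b * a = c
      ext
      · simp [sub_eq_add_neg]
      · simp only [sub_eq_add_neg, Unitization.snd_add, Unitization.snd_neg, Unitization.snd_mul,
          Unitization.fst_inr, Unitization.snd_inr, zero_smul, zero_add, add_zero]
        abel)
  rw [hmem, hcomm] at this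
  obtain ⟨x, hx, hxe⟩ := this
  exact Unitization.inr_injective hxe ▸ hx

/-- **Proposition 4.5 (a).** Every commutator `[a,b] = a*b - b*a` of a C*-algebra `A`
belongs to `CQ(A)`. In particular, `CQ(A) = Z(A)` if and only if `A` is abelian. -/
theorem stmt14 {A : Type*} [NonUnitalCStarAlgebra A] :
    (∀ a b : A, a * b - b * a ∈ CQset (Set.univ : Set A)) ∧
    (CQset (Set.univ : Set A) = centerOf (Set.univ : Set A) ↔
      ∀ a b : A, a * b = b * a) := by
  have hCQ (a b : A) : a * b - b * a ∈ CQset (Set.univ : Set A) := by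
    refine ⟨trivial, fun I hI hcen => ⟨0, ⟨trivial, by simp⟩, ?_⟩⟩
    rw [sub_zero]
    exact commutator_mem_of_isIdealOf_univ hI a b fun x => hcen x trivial
  refine ⟨hCQ, fun h a b => ?_, fun h => ?_⟩
  · have hbot : IsIdealOf ({0} : Set A) Set.univ := by
      refine ⟨Set.subset_univ _, isClosed_singleton, rfl, ?_, ?_, ?_⟩ <;> simp
    have hcen : a * b - b * a ∈ centerOf (Set.univ : Set A) := h ▸ hCQ a b
    exact sub_eq_zero.1 (commutator_mem_of_isIdealOf_univ hbot a b
      fun x => sub_eq_zero.2 (hcen.2 x trivial))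
  · have hcen (a : A) : a ∈ centerOf (Set.univ : Set A) := ⟨trivial, fun x _ => h a x⟩
    refine Set.Subset.antisymm (fun a _ => hcen a) fun a _ => ⟨trivial, fun I hI _ => ?_⟩
    exact ⟨a, hcen a, by rw [sub_self]; exact hI.2.2.1⟩
end
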